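/- arXiv:2208.07723 — 2 statements merged into one kernel-verified Lean document; each statement's English description precedes it below -/
import Mathlib

section
/- Let p_1,…,p_N be constants with 2N/(N+2) < p^∧ ≤ p^∨, p_h < N and p^∨ < p_h*. Then there exists a constant C, depending only on N, a and p_1,…,p_N, such that for every continuously differentiable function u on the closure of K_a: ‖u‖_{p_h*, K_a} ≤ C ( Σ_{i=1}^N ‖D_i u‖_{p_i, K_a} + ‖u‖_{1, K_a} ). -/
noncomputable section
open MeasureTheory Real Filter

/-- The open parallelepiped `K_a = {x : |x_i| < a_i}`. -/
def Ka {N : ℕ} (a : Fin N → ℝ) : Set (Fin N → ℝ) := {x | ∀ i, |x i| < a i}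

/-- The `i`-th partial derivative `D_i`. -/
def Dop {N : ℕ} (i : Fin N) (f : (Fin N → ℝ) → ℝ) : (Fin N → ℝ) → ℝ :=
  fun x => fderiv ℝ f x (Pi.single i 1)

/-- The `L^q(Ω)` norm. -/
def Lnorm {N : ℕ} (q : ℝ) (Ω : Set (Fin N → ℝ)) (v : (Fin N → ℝ) → ℝ) : ℝ :=
  (∫ x in Ω, |v x| ^ q) ^ (1 / q)

theorem Ka_eq {N : ℕ} (a : Fin N → ℝ) :
    Ka a = Set.pi Set.univ (fun i => Set.Ioo (-a i) (a i)) := by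
  ext x; simp [Ka, abs_lt]

theorem Ka_isOpen {N : ℕ} (a : Fin N → ℝ) : IsOpen (Ka a) := by
  rw [Ka_eq]; exact isOpen_set_pi Set.finite_univ (fun i _ => isOpen_Ioo)

theorem Ka_convex {N : ℕ} (a : Fin N → ℝ) : Convex ℝ (Ka a) := by
  rw [Ka_eq]; exact convex_pi (fun i _ => convex_Ioo _ _)

theorem Ka_subset {N : ℕ} (a : Fin N → ℝ) : Ka a ⊆ Set.Icc (fun i => -a i) a := by
  intro x hx
  exact ⟨fun i => (abs_lt.1 (hx i)).1.le, fun i => (abs_lt.1 (hx i)).2.le⟩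

theorem Ka_compact {N : ℕ} (a : Fin N → ℝ) : IsCompact (closure (Ka a)) :=
  isCompact_Icc.of_isClosed_subset isClosed_closure (closure_minimal (Ka_subset a) isClosed_Icc)

theorem Ka_finite {N : ℕ} (a : Fin N → ℝ) : volume (Ka a) < ⊤ :=
  lt_of_le_of_lt (measure_mono subset_closure) (Ka_compact a).measure_lt_top

theorem Ka_nonempty {N : ℕ} (a : Fin N → ℝ) (ha : ∀ i, 0 < a i) : (Ka a).Nonempty :=
  ⟨0, fun i => by simpa using ha i⟩

/-- `u` and its partial derivatives are continuous and bounded on `K_a`. -/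
theorem u_reg {N : ℕ} (a : Fin N → ℝ) (ha : ∀ i, 0 < a i) (u : (Fin N → ℝ) → ℝ)
    (hu : ContDiffOn ℝ 1 u (closure (Ka a))) :
    ContinuousOn u (Ka a) ∧ (∃ B, ∀ x ∈ Ka a, |u x| ≤ B) ∧
      ∀ i, ContinuousOn (Dop i u) (Ka a) ∧ ∃ B, ∀ x ∈ Ka a, |Dop i u x| ≤ B := by
  have hU : UniqueDiffOn ℝ (closure (Ka a)) := by
    refine uniqueDiffOn_convex (Ka_convex a).closure ?_
    exact (Ka_nonempty a ha).mono
      (interior_maximal subset_closure (Ka_isOpen a))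
  refine ⟨hu.continuousOn.mono subset_closure, ?_, fun i => ?_⟩
  · obtain ⟨B, hB⟩ := (Ka_compact a).exists_bound_of_continuousOn hu.continuousOn
    exact ⟨B, fun x hx => hB x (subset_closure hx)⟩
  · have hc : ContinuousOn (fun x => fderivWithin ℝ u (closure (Ka a)) x (Pi.single i 1))
        (closure (Ka a)) :=
      (hu.continuousOn_fderivWithin hU le_rfl).clm_apply continuousOn_const
    have he : Set.EqOn (Dop i u)
        (fun x => fderivWithin ℝ u (closure (Ka a)) x (Pi.single i 1)) (Ka a) := by
      intro x hx
      have : closure (Ka a) ∈ nhds x :=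
        Filter.mem_of_superset ((Ka_isOpen a).mem_nhds hx) subset_closure
      simp only [Dop]
      rw [fderivWithin_of_mem_nhds this]
    refine ⟨(hc.mono subset_closure).congr he, ?_⟩
    obtain ⟨B, hB⟩ := (Ka_compact a).exists_bound_of_continuousOn hc
    refine ⟨B, fun x hx => ?_⟩
    rw [he hx]
    exact hB x (subset_closure hx)

theorem memLp_Ka {N : ℕ} (a : Fin N → ℝ) (g : (Fin N → ℝ) → ℝ) (hg : ContinuousOn g (Ka a))
    (B : ℝ) (hB : ∀ x ∈ Ka a, |g x| ≤ B) (r : ENNReal) :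
    MemLp g r (volume.restrict (Ka a)) := by
  have : IsFiniteMeasure (volume.restrict (Ka a)) := ⟨by simpa using Ka_finite a⟩
  refine MemLp.of_bound (hg.aestronglyMeasurable (Ka_isOpen a).measurableSet) B ?_
  exact (ae_restrict_iff' (Ka_isOpen a).measurableSet).2 (ae_of_all _ hB)

theorem oneD (a : ℝ) (ha : 0 < a) (w : ℝ → ℝ) (hw : ContDiffOn ℝ 1 w (Set.Ioo (-a) a))
    (h0 : ∀ t, 0 ≤ w t) (y : ℝ) (hy : y ∈ Set.Ioo (-a) a) :
    ENNReal.ofReal (w y) ≤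
      ∫⁻ t in Set.Ioo (-a) a, ENNReal.ofReal (1 / (2 * a) * w t + |deriv w t|) := by
  have hdc : ContinuousOn (deriv w) (Set.Ioo (-a) a) :=
    hw.continuousOn_deriv_of_isOpen isOpen_Ioo le_rfl
  set D := ∫⁻ t in Set.Ioo (-a) a, ENNReal.ofReal |deriv w t| with hD
  have key : ∀ t ∈ Set.Ioo (-a) a, ENNReal.ofReal (w y) ≤ ENNReal.ofReal (w t) + D := by
    intro t ht
    have hsub : Set.uIcc t y ⊆ Set.Ioo (-a) a := (Set.ordConnected_Ioo).uIcc_subset ht hy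
    have hft : ∫ s in t..y, deriv w s = w y - w t := by
      refine intervalIntegral.integral_eq_sub_of_hasDerivAt (fun s hs => ?_)
        (hdc.mono hsub).intervalIntegrable
      exact ((hw.differentiableOn one_ne_zero).differentiableAt
        (isOpen_Ioo.mem_nhds (hsub hs))).hasDerivAt
    have h1 : ENNReal.ofReal |w y - w t| ≤ D := by
      rw [← hft, ← Real.norm_eq_abs, intervalIntegral.norm_intervalIntegral_eq,
        ofReal_norm]
      refine (enorm_integral_le_lintegral_enorm _).trans ?_
      rw [hD]
      simp only [← ofReal_norm, Real.norm_eq_abs]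
      exact lintegral_mono_set (Set.uIoc_subset_uIcc.trans hsub)
    calc ENNReal.ofReal (w y) ≤ ENNReal.ofReal (w t + |w y - w t|) :=
          ENNReal.ofReal_le_ofReal (by linarith [le_abs_self (w y - w t)])
      _ ≤ ENNReal.ofReal (w t) + ENNReal.ofReal |w y - w t| := ENNReal.ofReal_add_le
      _ ≤ _ := by gcongr
  have hc : 0 < 1 / (2 * a) := by positivity
  have hmeas : AEMeasurable (fun t => ENNReal.ofReal |deriv w t|)
      (volume.restrict (Set.Ioo (-a) a)) :=
    (hdc.abs.aemeasurable measurableSet_Ioo).ennreal_ofReal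
  have hsplit : ∫⁻ t in Set.Ioo (-a) a, ENNReal.ofReal (1 / (2 * a) * w t + |deriv w t|)
      = ENNReal.ofReal (1 / (2 * a)) * (∫⁻ t in Set.Ioo (-a) a, ENNReal.ofReal (w t)) + D := by
    rw [hD, ← lintegral_const_mul' _ _ ENNReal.ofReal_ne_top, ← lintegral_add_right' _ hmeas]
    refine lintegral_congr fun t => ?_
    rw [ENNReal.ofReal_add (mul_nonneg hc.le (h0 t)) (abs_nonneg _), ENNReal.ofReal_mul hc.le]
  have hvol : ENNReal.ofReal (1 / (2 * a)) * volume (Set.Ioo (-a) a) = 1 := by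
    rw [Real.volume_Ioo, ← ENNReal.ofReal_mul hc.le]
    have : 1 / (2 * a) * (a - -a) = 1 := by field_simp; ring
    rw [this, ENNReal.ofReal_one]
  rw [hsplit]
  have hint : ENNReal.ofReal (w y) * volume (Set.Ioo (-a) a) ≤
      (∫⁻ t in Set.Ioo (-a) a, ENNReal.ofReal (w t)) + D * volume (Set.Ioo (-a) a) := by
    rw [← setLIntegral_const, ← setLIntegral_const, ← lintegral_add_right' _ aemeasurable_const]
    exact setLIntegral_mono' measurableSet_Ioo key
  calc ENNReal.ofReal (w y)
      = ENNReal.ofReal (1 / (2 * a)) * (ENNReal.ofReal (w y) * volume (Set.Ioo (-a) a)) := by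
        rw [mul_left_comm, hvol, mul_one]
    _ ≤ ENNReal.ofReal (1 / (2 * a)) * ((∫⁻ t in Set.Ioo (-a) a, ENNReal.ofReal (w t))
          + D * volume (Set.Ioo (-a) a)) := by gcongr
    _ = _ := by rw [mul_add, mul_left_comm _ D, hvol, mul_one]

theorem young_aux (s q ε : ℝ) (hs : 1 < s) (hq : s < q) (hε : 0 < ε) :
    ∃ C, 0 < C ∧ ∀ t : ℝ, 0 ≤ t → t ^ s ≤ ε * t ^ q + C * t := by
  set T := (ε⁻¹) ^ (1 / (q - s)) with hT
  have hT0 : 0 < T := by positivity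
  have hTe : T ^ (s - q) = ε := by
    rw [hT, ← Real.rpow_mul (by positivity)]
    have : 1 / (q - s) * (s - q) = -1 := by
      have : q - s ≠ 0 := by linarith
      field_simp; ring
    rw [this, Real.rpow_neg_one, inv_inv]
  refine ⟨T ^ (s - 1), by positivity, fun t ht => ?_⟩
  rcases ht.eq_or_lt with rfl | ht
  · rw [Real.zero_rpow (by linarith), Real.zero_rpow (by linarith)]; simp
  rcases le_total t T with h | h
  · have : t ^ s = t ^ (s - 1) * t := by
      rw [← Real.rpow_add_one ht.ne']; ring_nf
    have h2 : t ^ (s - 1) ≤ T ^ (s - 1) := Real.rpow_le_rpow ht.le h (by linarith)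
    have h3 : 0 ≤ ε * t ^ q := by positivity
    nlinarith
  · have : t ^ s = t ^ (s - q) * t ^ q := by
      rw [← Real.rpow_add ht]; ring_nf
    have h2 : t ^ (s - q) ≤ T ^ (s - q) := Real.rpow_le_rpow_of_nonpos hT0 h (by linarith)
    rw [hTe] at h2
    have h3 : 0 < t ^ q := by positivity
    have h4 : 0 < T ^ (s - 1) * t := by positivity
    nlinarith

theorem Lnorm_nonneg {N : ℕ} (q : ℝ) (Ω : Set (Fin N → ℝ)) (v : (Fin N → ℝ) → ℝ) :
    0 ≤ Lnorm q Ω v :=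
  Real.rpow_nonneg (integral_nonneg fun x => Real.rpow_nonneg (abs_nonneg _) _) _

theorem Lnorm_smul {N : ℕ} (q : ℝ) (hq : 0 < q) (Ω : Set (Fin N → ℝ)) (v : (Fin N → ℝ) → ℝ)
    (c : ℝ) (hc : 0 < c) : Lnorm q Ω (fun x => c * v x) = c * Lnorm q Ω v := by
  unfold Lnorm
  have : ∀ x, |c * v x| ^ q = c ^ q * |v x| ^ q := fun x => by
    rw [abs_mul, abs_of_pos hc, Real.mul_rpow hc.le (abs_nonneg _)]
  simp only [this]
  rw [integral_const_mul, Real.mul_rpow (by positivity)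
    (integral_nonneg fun x => Real.rpow_nonneg (abs_nonneg _) _), ← Real.rpow_mul hc.le,
    mul_one_div_cancel hq.ne', Real.rpow_one]

theorem line_bound {N : ℕ} (a : Fin N → ℝ) (ha : ∀ i, 0 < a i) (u : (Fin N → ℝ) → ℝ)
    (hu : ContDiffOn ℝ 1 u (Ka a)) (i : Fin N) (s : ℝ) (hs : 1 < s) (x : Fin N → ℝ)
    (hx : x ∈ Ka a) :
    ENNReal.ofReal (|u x| ^ s) ≤ ∫⁻ t, (Ka a).indicator
      (fun z => ENNReal.ofReal (1 / (2 * a i) * |u z| ^ s + s * (|u z| ^ (s - 1) * |Dop i u z|)))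
      (Function.update x i t) := by
  have hmem : ∀ t, Function.update x i t ∈ Ka a ↔ t ∈ Set.Ioo (-a i) (a i) := by
    intro t
    constructor
    · intro h; have := h i; simpa [abs_lt] using this
    · intro h j
      by_cases hj : j = i
      · subst hj; simpa [abs_lt] using h
      · simpa [hj] using hx j
  have hupd : ContDiff ℝ 1 (fun t : ℝ => Function.update x i t) := contDiff_update 1 x i
  have habs : ContDiff ℝ 1 (fun z : ℝ => |z| ^ s) := by
    simpa using contDiff_norm_rpow (E := ℝ) hs
  set w : ℝ → ℝ := fun t => |u (Function.update x i t)| ^ s with hwdef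
  have hw : ContDiffOn ℝ 1 w (Set.Ioo (-a i) (a i)) :=
    habs.comp_contDiffOn (hu.comp hupd.contDiffOn (fun t ht => (hmem t).2 ht))
  have hder : ∀ t ∈ Set.Ioo (-a i) (a i), |deriv w t| =
      s * (|u (Function.update x i t)| ^ (s - 1) * |Dop i u (Function.update x i t)|) := by
    intro t ht
    have hd : DifferentiableAt ℝ u (Function.update x i t) :=
      (hu.differentiableOn one_ne_zero).differentiableAt
        ((Ka_isOpen a).mem_nhds ((hmem t).2 ht))
    have h1 := hd.hasFDerivAt.comp_hasDerivAt t (hasDerivAt_update x i t)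
    have h2 := (hasDerivAt_abs_rpow (u (Function.update x i t)) hs).comp t h1
    have h3 : deriv w t = _ := h2.deriv
    rw [h3, abs_mul, abs_mul, abs_mul, abs_of_pos (by linarith : 0 < s),
      abs_of_nonneg (Real.rpow_nonneg (abs_nonneg (u (Function.update x i t))) (s - 2)),
      mul_assoc s, mul_assoc s]
    congr 2
    rcases eq_or_ne (u (Function.update x i t)) 0 with h | h
    · rw [h, abs_zero, mul_zero, Real.zero_rpow (by linarith)]
    · rw [← Real.rpow_add_one (abs_ne_zero.2 h)]; ring_nf
  have h1 := oneD (a i) (ha i) w hw (fun t => Real.rpow_nonneg (abs_nonneg _) _) (x i)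
    (by simpa [abs_lt] using hx i)
  have hwx : w (x i) = |u x| ^ s := by simp [hwdef]
  rw [hwx] at h1
  refine h1.trans (le_of_eq ?_)
  rw [← lintegral_indicator measurableSet_Ioo]
  refine lintegral_congr fun t => ?_
  by_cases ht : t ∈ Set.Ioo (-a i) (a i)
  · rw [Set.indicator_of_mem ht, Set.indicator_of_mem ((hmem t).2 ht), hder t ht]
  · rw [Set.indicator_of_notMem ht, Set.indicator_of_notMem (fun h => ht ((hmem t).1 h))]

theorem core (N : ℕ) (hN : 2 ≤ N) (a : Fin N → ℝ) (ha : ∀ i, 0 < a i)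
    (p : Fin N → ℝ) (hp : ∀ i, 1 < p i) (q : ℝ) (hpq : ∀ i, p i < q)
    (hsum : ∑ i, (p i)⁻¹ = 1 + N / q) (hq0 : 0 < q) :
    ∃ C : ℝ, 0 < C ∧
      ∀ u : (Fin N → ℝ) → ℝ, ContDiffOn ℝ 1 u (closure (Ka a)) → Lnorm q (Ka a) u = 1 →
        1 ≤ C * ((∑ i, Lnorm (p i) (Ka a) (Dop i u)) + Lnorm 1 (Ka a) u) := by
  have hN2 : (2 : ℝ) ≤ N := by exact_mod_cast hN
  set s : Fin N → ℝ := fun i => 1 + q * (1 - (p i)⁻¹) with hs_def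
  set c : Fin N → ℝ := fun i => 1 / (2 * a i) with hc_def
  have hc : ∀ i, 0 < c i := fun i => by have := ha i; simp only [hc_def]; positivity
  have hs1 : ∀ i, 1 < s i := fun i => by
    have : (p i)⁻¹ < 1 := inv_lt_one_of_one_lt₀ (hp i)
    have : 0 < q * (1 - (p i)⁻¹) := mul_pos hq0 (by linarith)
    simp only [hs_def]; linarith
  have hsq : ∀ i, s i < q := fun i => by
    have h0 : 0 < p i := by linarith [hp i]
    have : 1 < q * (p i)⁻¹ := by
      rw [← div_eq_mul_inv, one_lt_div h0]; exact hpq i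
    simp only [hs_def]; linarith
  have hssum : ∑ i, s i * (1 / ((N : ℝ) - 1)) = q := by
    rw [← Finset.sum_mul]
    simp only [hs_def, Finset.sum_add_distrib, ← Finset.mul_sum, Finset.sum_sub_distrib, hsum,
      Finset.sum_const, Finset.card_univ, Fintype.card_fin, nsmul_eq_mul, mul_one]
    have : (N : ℝ) - 1 ≠ 0 := by linarith
    field_simp
    ring
  have hy : ∀ i, ∃ C, 0 < C ∧ ∀ t : ℝ, 0 ≤ t → t ^ (s i) ≤ (1 / (2 * N * c i)) * t ^ q + C * t :=
    fun i => young_aux (s i) q _ (hs1 i) (hsq i) (by have := hc i; positivity)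
  choose Cy hCy0 hCy using hy
  have hterm : ∀ i, 0 < c i * Cy i + s i := fun i => by
    have := mul_pos (hc i) (hCy0 i); linarith [hs1 i]
  have hne : (Finset.univ : Finset (Fin N)).Nonempty := ⟨⟨0, by omega⟩, Finset.mem_univ _⟩
  have hS0 : 0 < ∑ i, (c i * Cy i + s i) := Finset.sum_pos (fun i _ => hterm i) hne
  refine ⟨2 * ∑ i, (c i * Cy i + s i), by positivity, fun u hu hU => ?_⟩
  obtain ⟨huc, ⟨B, hB⟩, hD⟩ := u_reg a ha u hu
  have hKm : MeasurableSet (Ka a) := (Ka_isOpen a).measurableSet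
  have hfin : IsFiniteMeasure (volume.restrict (Ka a)) := ⟨by simpa using Ka_finite a⟩
  -- powers of `u`
  have hpowc : ∀ r : ℝ, 0 ≤ r → ContinuousOn (fun x => |u x| ^ r) (Ka a) := fun r hr =>
    huc.abs.rpow_const (fun x _ => Or.inr hr)
  have hpowb : ∀ r : ℝ, 0 ≤ r → ∀ x ∈ Ka a, |(|u x| ^ r)| ≤ B ^ r := fun r hr x hx => by
    rw [abs_of_nonneg (Real.rpow_nonneg (abs_nonneg _) _)]
    exact Real.rpow_le_rpow (abs_nonneg _) (hB x hx) hr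
  have hpowL : ∀ r : ℝ, 0 ≤ r → ∀ m : ENNReal,
      MemLp (fun x => |u x| ^ r) m (volume.restrict (Ka a)) := fun r hr m =>
    memLp_Ka a _ (hpowc r hr) _ (hpowb r hr) m
  have hpowI : ∀ r : ℝ, 0 ≤ r → Integrable (fun x => |u x| ^ r) (volume.restrict (Ka a)) :=
    fun r hr => memLp_one_iff_integrable.1 (hpowL r hr 1)
  have hDL : ∀ i (m : ENNReal), MemLp (fun x => |Dop i u x|) m (volume.restrict (Ka a)) := by
    intro i m
    obtain ⟨h1, Bd, h2⟩ := hD i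
    exact memLp_Ka a _ h1.abs Bd (fun x hx => by rw [abs_abs]; exact h2 x hx) m
  have hI : ∫ x in Ka a, |u x| ^ q = 1 := by
    have h0 : 0 ≤ ∫ x in Ka a, |u x| ^ q :=
      integral_nonneg fun x => Real.rpow_nonneg (abs_nonneg _) _
    have h1 : ((∫ x in Ka a, |u x| ^ q) ^ (1 / q)) ^ q = 1 := by
      have : (∫ x in Ka a, |u x| ^ q) ^ (1 / q) = 1 := hU
      rw [this, Real.one_rpow]
    rwa [← Real.rpow_mul h0, one_div_mul_cancel hq0.ne', Real.rpow_one] at h1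
  have hL1 : Lnorm 1 (Ka a) u = ∫ x in Ka a, |u x| := by simp [Lnorm]
  have huI : Integrable (fun x => |u x|) (volume.restrict (Ka a)) := by
    simpa using hpowI 1 zero_le_one
  set F : Fin N → (Fin N → ℝ) → ℝ := fun i z =>
    1 / (2 * a i) * |u z| ^ (s i) + s i * (|u z| ^ (s i - 1) * |Dop i u z|) with hF
  have hF0 : ∀ i z, 0 ≤ F i z := fun i z => by
    have := ha i
    have := hs1 i
    simp only [hF]; positivity
  have hFc : ∀ i, ContinuousOn (F i) (Ka a) := fun i => by
    have h1 := hs1 i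
    exact (continuousOn_const.mul (hpowc _ (by linarith))).add
      (continuousOn_const.mul ((hpowc _ (by linarith)).mul (hD i).1.abs))
  have hprodI : ∀ i, Integrable (fun z => |u z| ^ (s i - 1) * |Dop i u z|)
      (volume.restrict (Ka a)) := fun i =>
    (hpowL (s i - 1) (by linarith [hs1 i]) 2).integrable_mul (hDL i 2)
  have hFI : ∀ i, Integrable (F i) (volume.restrict (Ka a)) := fun i =>
    ((hpowI (s i) (by linarith [hs1 i])).const_mul _).add ((hprodI i).const_mul _)
  -- upper bound
  have hA : ∀ i, ∫ x in Ka a, F i x ≤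
      1 / (2 * N) + c i * Cy i * Lnorm 1 (Ka a) u + s i * Lnorm (p i) (Ka a) (Dop i u) := by
    intro i
    have hpi := hp i
    have hsi := hs1 i
    have e1 : ∫ x in Ka a, F i x = c i * (∫ x in Ka a, |u x| ^ (s i)) +
        s i * ∫ x in Ka a, |u x| ^ (s i - 1) * |Dop i u x| := by
      rw [← integral_const_mul, ← integral_const_mul]
      exact integral_add ((hpowI (s i) (by linarith)).const_mul _) ((hprodI i).const_mul _)
    have e2 : ∫ x in Ka a, |u x| ^ (s i) ≤ 1 / (2 * N * c i) + Cy i * Lnorm 1 (Ka a) u := by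
      have h := integral_mono (hpowI (s i) (by linarith))
        (((hpowI q hq0.le).const_mul (1 / (2 * N * c i))).add (huI.const_mul (Cy i)))
        (fun x => hCy i |u x| (abs_nonneg _))
      refine h.trans (le_of_eq ?_)
      rw [hL1]
      refine (integral_add ((hpowI q hq0.le).const_mul _) (huI.const_mul _)).trans ?_
      rw [integral_const_mul, integral_const_mul, hI, mul_one]
    have hconj : (Real.conjExponent (p i)).HolderConjugate (p i) :=
      (Real.HolderConjugate.conjExponent hpi).symm
    have hexp : (s i - 1) * Real.conjExponent (p i) = q := by
      simp only [hs_def, Real.conjExponent]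
      have : p i - 1 ≠ 0 := by linarith
      have : p i ≠ 0 := by linarith
      field_simp
      ring
    have e3 : ∫ x in Ka a, |u x| ^ (s i - 1) * |Dop i u x| ≤ Lnorm (p i) (Ka a) (Dop i u) := by
      have h := integral_mul_le_Lp_mul_Lq_of_nonneg (μ := volume.restrict (Ka a)) hconj
        (f := fun x => |u x| ^ (s i - 1)) (g := fun x => |Dop i u x|)
        (ae_of_all _ fun x => Real.rpow_nonneg (abs_nonneg _) _)
        (ae_of_all _ fun x => abs_nonneg _)
        (hpowL _ (by linarith) _) (hDL i _)
      refine h.trans (le_of_eq ?_)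
      simp only [← Real.rpow_mul (abs_nonneg _), hexp, hI, Real.one_rpow, one_mul]
      rfl
    rw [e1]
    have hci := hc i
    calc _ ≤ c i * (1 / (2 * N * c i) + Cy i * Lnorm 1 (Ka a) u) +
          s i * Lnorm (p i) (Ka a) (Dop i u) := by gcongr
      _ = _ := by field_simp
  -- lower bound
  have hBd : 1 ≤ ∑ i, ∫ x in Ka a, F i x := by
    set f : (Fin N → ℝ) → ENNReal := fun z =>
      ∑ i, (Ka a).indicator (fun z => ENNReal.ofReal (F i z)) z with hf
    have hfi : ∀ i, Measurable ((Ka a).indicator (fun z => ENNReal.ofReal (F i z))) := by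
      intro i
      classical
      rw [← Set.piecewise_eq_indicator]
      exact ContinuousOn.measurable_piecewise
        (ENNReal.continuous_ofReal.comp_continuousOn (hFc i)) continuousOn_const hKm
    have hfm : Measurable f := Finset.measurable_sum _ (fun i _ => hfi i)
    have hconj : Real.HolderConjugate (Fintype.card (Fin N)) (Real.conjExponent N) := by
      rw [Fintype.card_fin]
      exact Real.HolderConjugate.conjExponent (by linarith)
    have hgrid := lintegral_prod_lintegral_pow_le (fun _ : Fin N => (volume : Measure ℝ))
      hconj hfm
    rw [← volume_pi, Fintype.card_fin] at hgrid
    have hlow : (1 : ENNReal) ≤ ∫⁻ x : Fin N → ℝ, ∏ i,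
        (∫⁻ t, f (Function.update x i t)) ^ ((1 : ℝ) / ((N : ℝ) - 1)) := by
      have h1 : (1 : ENNReal) = ∫⁻ x in Ka a, ENNReal.ofReal (|u x| ^ q) := by
        rw [← ofReal_integral_eq_lintegral_ofReal (hpowI q hq0.le)
          (ae_of_all _ fun x => Real.rpow_nonneg (abs_nonneg _) _), hI, ENNReal.ofReal_one]
      rw [h1]
      refine (setLIntegral_mono' hKm (fun x hx => ?_)).trans (setLIntegral_le_lintegral (Ka a) _)
      have hNN : 0 ≤ (1 : ℝ) / ((N : ℝ) - 1) := by
        have : 0 < (N : ℝ) - 1 := by linarith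
        positivity
      have h2 : ENNReal.ofReal (|u x| ^ q) =
          ∏ i, (ENNReal.ofReal (|u x| ^ (s i))) ^ ((1 : ℝ) / ((N : ℝ) - 1)) := by
        rw [← hssum, Real.rpow_sum_of_nonneg (abs_nonneg _)
          (fun i _ => mul_nonneg (by linarith [hs1 i]) hNN),
          ENNReal.ofReal_prod_of_nonneg (fun i _ => Real.rpow_nonneg (abs_nonneg _) _)]
        refine Finset.prod_congr rfl fun i _ => ?_
        rw [ENNReal.ofReal_rpow_of_nonneg (Real.rpow_nonneg (abs_nonneg _) _) hNN,
          ← Real.rpow_mul (abs_nonneg _)]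
      rw [h2]
      refine Finset.prod_le_prod' fun i _ => ?_
      refine ENNReal.rpow_le_rpow ?_ hNN
      refine (line_bound a ha u (hu.mono subset_closure) i (s i) (hs1 i) x hx).trans ?_
      refine lintegral_mono fun t => ?_
      exact Finset.single_le_sum
        (f := fun j => (Ka a).indicator (fun z => ENNReal.ofReal (F j z)) (Function.update x i t))
        (fun j _ => zero_le) (Finset.mem_univ i)
    have h3 : (1 : ENNReal) ≤ ∫⁻ x, f x := by
      by_contra hlt
      push Not at hlt
      exact absurd (hlow.trans hgrid) (not_le.2 (ENNReal.rpow_lt_one hlt hconj.symm.pos))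
    have h4 : ∫⁻ x, f x = ENNReal.ofReal (∑ i, ∫ x in Ka a, F i x) := by
      rw [hf, lintegral_finsetSum _ (fun i _ => hfi i),
        ENNReal.ofReal_sum_of_nonneg (fun i _ => integral_nonneg (hF0 i))]
      refine Finset.sum_congr rfl fun i _ => ?_
      rw [lintegral_indicator hKm, ofReal_integral_eq_lintegral_ofReal (hFI i)
        (ae_of_all _ (hF0 i))]
    rw [h4] at h3
    exact ENNReal.one_le_ofReal.1 h3
  -- conclusion
  set M := (∑ i, Lnorm (p i) (Ka a) (Dop i u)) + Lnorm 1 (Ka a) u with hM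
  have hDi : ∀ i, Lnorm (p i) (Ka a) (Dop i u) ≤ M := fun i => by
    have := Finset.single_le_sum (f := fun i => Lnorm (p i) (Ka a) (Dop i u))
      (fun j _ => Lnorm_nonneg _ _ _) (Finset.mem_univ i)
    have h2 := Lnorm_nonneg 1 (Ka a) u
    linarith
  have hL1M : Lnorm 1 (Ka a) u ≤ M := by
    have := Finset.sum_nonneg (s := Finset.univ) (f := fun i => Lnorm (p i) (Ka a) (Dop i u))
      (fun j _ => Lnorm_nonneg _ _ _)
    linarith
  have hfinal : 1 ≤ ∑ i : Fin N, (1 / (2 * (N : ℝ)) + (c i * Cy i + s i) * M) := by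
    refine hBd.trans (Finset.sum_le_sum fun i _ => (hA i).trans ?_)
    have h1 : c i * Cy i * Lnorm 1 (Ka a) u ≤ c i * Cy i * M :=
      mul_le_mul_of_nonneg_left hL1M (mul_pos (hc i) (hCy0 i)).le
    have h2 : s i * Lnorm (p i) (Ka a) (Dop i u) ≤ s i * M :=
      mul_le_mul_of_nonneg_left (hDi i) (by linarith [hs1 i])
    linarith
  rw [Finset.sum_add_distrib, ← Finset.sum_mul, Finset.sum_const, Finset.card_univ,
    Fintype.card_fin, nsmul_eq_mul] at hfinal
  have : (N : ℝ) * (1 / (2 * N)) = 1 / 2 := by field_simp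
  linarith

theorem stmt6 (N : ℕ) (hN : 2 ≤ N) (a : Fin N → ℝ) (ha : ∀ i, 0 < a i)
    (p : Fin N → ℝ) (hp : ∀ i, 2 * N / (N + 2) < p i)
    (ph phs : ℝ) (hph : ph = N / ∑ i, (p i)⁻¹) (hphN : ph < N)
    (hphs : phs = N * ph / (N - ph)) (hpv : ∀ i, p i < phs) :
    ∃ C : ℝ, 0 < C ∧
      ∀ u : (Fin N → ℝ) → ℝ, ContDiffOn ℝ 1 u (closure (Ka a)) →
        Lnorm phs (Ka a) u ≤
          C * ((∑ i, Lnorm (p i) (Ka a) (Dop i u)) + Lnorm 1 (Ka a) u) := by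

  have hN2 : (2 : ℝ) ≤ N := by exact_mod_cast hN
  have hp1 : ∀ i, 1 < p i := fun i => by
    refine lt_of_le_of_lt ?_ (hp i)
    rw [le_div_iff₀ (by positivity)]; linarith
  have hp0 : ∀ i, 0 < p i := fun i => by linarith [hp1 i]
  set S := ∑ i, (p i)⁻¹ with hS
  have hS0 : 0 < S := Finset.sum_pos (fun i _ => inv_pos.2 (hp0 i))
    ⟨⟨0, by omega⟩, Finset.mem_univ _⟩
  have hS1 : 1 < S := by
    rw [hph, div_lt_iff₀ hS0] at hphN
    nlinarith
  have hq : phs = N / (S - 1) := by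
    have h1 : S - 1 ≠ 0 := by linarith
    have h2 : (N : ℝ) - N / S ≠ 0 := by
      have : (N : ℝ) - N / S = N * (S - 1) / S := by field_simp
      rw [this]; positivity
    rw [hphs, hph, div_eq_div_iff h2 h1]
    field_simp
  have hq0 : 0 < phs := by
    rw [hq]; exact div_pos (by linarith) (by linarith)
  obtain ⟨C, hC, hmain⟩ := core N hN a ha p hp1 phs hpv (by
    rw [← hS, hq]
    have h1 : S - 1 ≠ 0 := by linarith
    field_simp
    ring) hq0
  refine ⟨C, hC, fun u hu => ?_⟩
  have hR : 0 ≤ (∑ i, Lnorm (p i) (Ka a) (Dop i u)) + Lnorm 1 (Ka a) u :=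
    add_nonneg (Finset.sum_nonneg fun i _ => Lnorm_nonneg _ _ _) (Lnorm_nonneg _ _ _)
  rcases (Lnorm_nonneg phs (Ka a) u).eq_or_lt with h0 | h0
  · rw [← h0]; positivity
  set U := Lnorm phs (Ka a) u with hU
  have hUi : 0 < U⁻¹ := inv_pos.2 h0
  have h := hmain (fun x => U⁻¹ * u x) (contDiffOn_const.mul hu)
    (by rw [Lnorm_smul _ hq0 _ _ _ hUi, ← hU, inv_mul_cancel₀ h0.ne'])
  have hd : ∀ i, Lnorm (p i) (Ka a) (Dop i (fun x => U⁻¹ * u x)) =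
      U⁻¹ * Lnorm (p i) (Ka a) (Dop i u) := by
    intro i
    rw [← Lnorm_smul _ (hp0 i) _ _ _ hUi]
    congr 1
    funext x
    have : (fun x => U⁻¹ * u x) = U⁻¹ • u := rfl
    simp only [Dop]
    rw [this, fderiv_const_smul_field]
    simp
  simp only [hd] at h
  rw [Lnorm_smul _ one_pos _ _ _ hUi, ← Finset.mul_sum, ← mul_add, mul_left_comm,
    inv_mul_eq_div, le_div_iff₀ h0, one_mul] at h
  exact h
end
end

section
/- Let N ≥ 2, L ≥ 0, and let p_1,…,p_N : closure(K_a) → ℝ be Lipschitz continuous with Lipschitz constant at most L, with p_i(x) > 2N/(N+2) on closure(K_a) and μ := sup_{K_a} p^∨(x)/p^∧(x) < 1 + 1/N. Then there exists β > 0, depending on a, L, N and the bounds of the p_i, such that μ + γ < 1 + 1/N where γ = 2βL√N·((N+2)²/(4N²))·(max_j max p_j + min_j min p_j + 2), and with the following property. For every closed axis-parallel cube K_b ⊂ closure(K_a) of edge length b ≤ β, every r with 2/(N+2) < r < 2 − (μ+γ)·2N/(N+2), every j ∈ {1,…,N}, every ε ∈ (0,1), every M₀ > 0 and every λ > 0,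 there is a constant C (depending on λ, M₀ and the data but not on ε or u) such that for every continuously differentiable u on K_b with ‖u‖_{2,K_b} ≤ M₀: ∫_{K_b} u² (ε² + |D_j u|²)^{(p_j(x) + 2(r−1))/2} dx ≤ λ Σ_{i=1}^N ∫_{K_b} |D_i u|^{q_i^-} dx + C, where q_i^- = min_{K_b} p_i + r. -/
noncomputable section
open MeasureTheory Real

/-- A closed axis-parallel cube with corner `c` and edge length `b`. -/
def Cube {N : ℕ} (c : Fin N → ℝ) (b : ℝ) : Set (Fin N → ℝ) :=
  {x | ∀ i, c i ≤ x i ∧ x i ≤ c i + b}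

lemma young_eps (P Q : ℝ) (h : P.HolderConjugate Q) (δ : ℝ) (hδ : 0 < δ) :
    ∃ C : ℝ, 0 ≤ C ∧ ∀ a b : ℝ, 0 ≤ a → 0 ≤ b → a * b ≤ δ * a ^ P + C * b ^ Q := by
  have hP := h.lt
  have hQ := h.symm.lt
  refine ⟨(δ ^ (-(1 / P))) ^ Q, by positivity, fun a b ha hb => ?_⟩
  have h1 := Real.young_inequality_of_nonneg (a := δ ^ (1 / P) * a) (b := δ ^ (-(1 / P)) * b)
    (by positivity) (by positivity) h
  have h2 : δ ^ (1 / P) * a * (δ ^ (-(1 / P)) * b) = a * b := by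
    rw [Real.rpow_neg hδ.le]
    have : δ ^ (1 / P) ≠ 0 := by positivity
    field_simp
  rw [h2, Real.mul_rpow (by positivity) ha, Real.mul_rpow (by positivity) hb,
    ← Real.rpow_mul hδ.le, one_div_mul_cancel (by linarith), Real.rpow_one] at h1
  have h3 : δ * a ^ P / P ≤ δ * a ^ P := div_le_self (by positivity) hP.le
  have h4 : (δ ^ (-(1 / P))) ^ Q * b ^ Q / Q ≤ (δ ^ (-(1 / P))) ^ Q * b ^ Q :=
    div_le_self (by positivity) hQ.le
  linarith

lemma young_one (P Q : ℝ) (h : P.HolderConjugate Q) (a b : ℝ) (ha : 0 ≤ a) (hb : 0 ≤ b) :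
    a * b ≤ a ^ P + b ^ Q := by
  have h1 := Real.young_inequality_of_nonneg ha hb h
  have h3 : a ^ P / P ≤ a ^ P := div_le_self (by positivity) h.lt.le
  have h4 : b ^ Q / Q ≤ b ^ Q := div_le_self (by positivity) h.symm.lt.le
  linarith

lemma sublin (κ K δ : ℝ) (hκ0 : 0 < κ) (hκ1 : κ < 1) (hK : 0 ≤ K) (hδ : 0 < δ) :
    ∃ C : ℝ, ∀ Y : ℝ, 0 ≤ Y → K * Y ^ κ ≤ δ * Y + C := by
  have hc : (1 / κ).HolderConjugate (1 / (1 - κ)) := by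
    refine Real.holderConjugate_iff.2 ⟨?_, ?_⟩
    · rw [lt_div_iff₀ hκ0]; linarith
    · simp
  obtain ⟨C, hC, h⟩ := young_eps _ _ hc δ hδ
  refine ⟨C * K ^ (1 / (1 - κ)), fun Y hY => ?_⟩
  have := h (Y ^ κ) K (by positivity) hK
  rw [← Real.rpow_mul hY, mul_one_div_cancel hκ0.ne', Real.rpow_one] at this
  linarith

lemma rpow_le_one_add (x s t : ℝ) (hx : 0 ≤ x) (hs : 0 ≤ s) (hst : s ≤ t) :
    x ^ s ≤ 1 + x ^ t := by
  rcases le_total x 1 with h | h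
  · have := Real.rpow_le_one hx h hs
    have : 0 ≤ x ^ t := by positivity
    linarith
  · have := Real.rpow_le_rpow_of_exponent_le h hst
    linarith

lemma line_bound_s14 (A B : ℝ) (hAB : A < B) (g g' : ℝ → ℝ)
    (hg : ∀ t ∈ Set.Ioo A B, HasDerivAt g (g' t) t)
    (hg' : ContinuousOn g' (Set.Ioo A B)) (hg0 : ∀ t, 0 ≤ g t)
    (t : ℝ) (ht : t ∈ Set.Ioo A B) :
    ENNReal.ofReal (g t) ≤
      ∫⁻ s in Set.Ioo A B, ENNReal.ofReal (g s / (B - A) + |g' s|) := by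
  have hgc : ContinuousOn g (Set.Ioo A B) := fun x hx => (hg x hx).continuousAt.continuousWithinAt
  have hBA : 0 < B - A := by linarith
  set I := ∫⁻ s in Set.Ioo A B, ENNReal.ofReal (|g' s|) with hI
  have key : ∀ s ∈ Set.Ioo A B, ENNReal.ofReal (g t) ≤ ENNReal.ofReal (g s) + I := by
    intro s hs
    have hsub : Set.uIcc s t ⊆ Set.Ioo A B := (Set.ordConnected_Ioo).uIcc_subset hs ht
    have hbnd : IntegrableOn (fun y => |g' y|) (Set.uIcc s t) :=
      ((hg'.mono hsub).abs).integrableOn_compact isCompact_uIcc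
    have e1 : g t ≤ g s + ∫ y in Set.uIcc s t, |g' y| := by
      have := intervalIntegral.integral_eq_sub_of_hasDerivAt (f := g) (f' := g') (a := s) (b := t)
        (fun x hx => hg x (hsub hx)) ((hg'.mono hsub).intervalIntegrable)
      have h2 := intervalIntegral.norm_integral_le_integral_norm_uIoc (f := g') (a := s) (b := t)
        (μ := volume)
      rw [this] at h2
      simp only [Real.norm_eq_abs] at h2
      have h3 : ∫ y in Set.uIoc s t, |g' y| ≤ ∫ y in Set.uIcc s t, |g' y| :=
        setIntegral_mono_set hbnd (ae_of_all _ fun x => abs_nonneg _)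
          (Filter.Eventually.of_forall Set.uIoc_subset_uIcc)
      linarith [le_abs_self (g t - g s)]
    calc ENNReal.ofReal (g t) ≤ ENNReal.ofReal (g s + ∫ y in Set.uIcc s t, |g' y|) :=
          ENNReal.ofReal_le_ofReal e1
      _ ≤ ENNReal.ofReal (g s) + ENNReal.ofReal (∫ y in Set.uIcc s t, |g' y|) :=
          ENNReal.ofReal_add_le
      _ ≤ ENNReal.ofReal (g s) + I := by
          gcongr
          rw [ofReal_integral_eq_lintegral_ofReal hbnd (ae_of_all _ fun x => abs_nonneg _)]
          exact lintegral_mono_set hsub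
  have hvol : volume (Set.Ioo A B) = ENNReal.ofReal (B - A) := Real.volume_Ioo
  have hne : ENNReal.ofReal (B - A) ≠ 0 := by simpa using hBA
  have hnt : ENNReal.ofReal (B - A) ≠ ⊤ := ENNReal.ofReal_ne_top
  have h5 : ENNReal.ofReal (g t) * ENNReal.ofReal (B - A) ≤
      (∫⁻ s in Set.Ioo A B, ENNReal.ofReal (g s)) + I * ENNReal.ofReal (B - A) := by
    calc _ = ∫⁻ s in Set.Ioo A B, ENNReal.ofReal (g t) := by
          rw [setLIntegral_const, hvol]
      _ ≤ ∫⁻ s in Set.Ioo A B, (ENNReal.ofReal (g s) + I) :=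
          setLIntegral_mono' measurableSet_Ioo key
      _ = _ := by rw [lintegral_add_right _ measurable_const, setLIntegral_const, hvol]
  have hm1 : AEMeasurable (fun s => ENNReal.ofReal (g s / (B - A)))
      (volume.restrict (Set.Ioo A B)) :=
    ((hgc.div_const _).aemeasurable measurableSet_Ioo).ennreal_ofReal
  have h6 : ∫⁻ s in Set.Ioo A B, ENNReal.ofReal (g s / (B - A) + |g' s|) =
      (∫⁻ s in Set.Ioo A B, ENNReal.ofReal (g s)) / ENNReal.ofReal (B - A) + I := by
    rw [hI, div_eq_mul_inv, ← lintegral_mul_const' _ _ (by simpa using hBA), ← lintegral_add_left']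
    · refine lintegral_congr fun s => ?_
      rw [ENNReal.ofReal_add (div_nonneg (hg0 s) hBA.le) (abs_nonneg _),
        ENNReal.ofReal_div_of_pos hBA, div_eq_mul_inv]
    · exact ((hgc.aemeasurable measurableSet_Ioo).ennreal_ofReal).mul_const _
  rw [h6]
  rw [← ENNReal.mul_le_mul_iff_left hne hnt, add_mul, ENNReal.div_mul_cancel hne hnt]
  exact h5

/-- The open cube. -/
def OCube {N : ℕ} (c : Fin N → ℝ) (b : ℝ) : Set (Fin N → ℝ) :=
  Set.univ.pi fun i => Set.Ioo (c i) (c i + b)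

lemma Cube_eq {N : ℕ} (c : Fin N → ℝ) (b : ℝ) :
    Cube c b = Set.Icc c (fun i => c i + b) := by
  ext x
  simp only [Cube, Set.mem_ofPred_eq, Set.mem_Icc, Pi.le_def]
  exact forall_and

lemma Cube_eq_pi {N : ℕ} (c : Fin N → ℝ) (b : ℝ) :
    Cube c b = Set.univ.pi fun i => Set.Icc (c i) (c i + b) := by
  ext x
  simp only [Cube, Set.mem_pi, Set.mem_univ, true_implies, Set.mem_Icc]
  rfl

lemma OCube_sub {N : ℕ} (c : Fin N → ℝ) (b : ℝ) : OCube c b ⊆ Cube c b := by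
  rw [Cube_eq_pi]
  exact Set.pi_mono fun i _ => Set.Ioo_subset_Icc_self

lemma OCube_open {N : ℕ} (c : Fin N → ℝ) (b : ℝ) : IsOpen (OCube c b) :=
  isOpen_set_pi Set.finite_univ fun i _ => isOpen_Ioo

lemma OCube_ae {N : ℕ} (c : Fin N → ℝ) (b : ℝ) : OCube c b =ᵐ[volume] Cube c b := by
  rw [Cube_eq, volume_pi]
  exact Measure.univ_pi_Ioo_ae_eq_Icc

lemma Cube_compact {N : ℕ} (c : Fin N → ℝ) (b : ℝ) : IsCompact (Cube c b) := by
  rw [Cube_eq]; exact isCompact_Icc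

lemma Cube_meas {N : ℕ} (c : Fin N → ℝ) (b : ℝ) : MeasurableSet (Cube c b) := by
  rw [Cube_eq]; exact measurableSet_Icc

lemma u_diff {N : ℕ} {c : Fin N → ℝ} {b : ℝ} {u : (Fin N → ℝ) → ℝ}
    (hu : ContDiffOn ℝ 1 u (Cube c b)) {x : Fin N → ℝ} (hx : x ∈ OCube c b) :
    HasFDerivAt u (fderiv ℝ u x) x := by
  have h1 : Cube c b ∈ nhds x :=
    Filter.mem_of_superset ((OCube_open c b).mem_nhds hx) (OCube_sub c b)
  exact ((hu.contDiffAt h1).differentiableAt (by norm_num)).hasFDerivAt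

lemma Dop_cont {N : ℕ} {c : Fin N → ℝ} {b : ℝ} {u : (Fin N → ℝ) → ℝ}
    (hu : ContDiffOn ℝ 1 u (Cube c b)) (i : Fin N) : ContinuousOn (Dop i u) (OCube c b) := by
  have h := (hu.mono (OCube_sub c b)).continuousOn_fderiv_of_isOpen (OCube_open c b) le_rfl
  exact h.clm_apply continuousOn_const

lemma Dop_int {N : ℕ} {c : Fin N → ℝ} {b : ℝ} (hb : 0 < b) {u : (Fin N → ℝ) → ℝ}
    (hu : ContDiffOn ℝ 1 u (Cube c b)) (i : Fin N) (q : ℝ) (hq : 0 ≤ q) :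
    IntegrableOn (fun x => |Dop i u x| ^ q) (Cube c b) := by
  have hU : UniqueDiffOn ℝ (Cube c b) := by
    rw [Cube_eq_pi]
    exact UniqueDiffOn.pi fun i _ => uniqueDiffOn_Icc (by linarith)
  have h := (hu.continuousOn_fderivWithin hU le_rfl).clm_apply
    (continuousOn_const (c := (Pi.single i 1 : Fin N → ℝ)))
  have h2 : ContinuousOn (fun x => |fderivWithin ℝ u (Cube c b) x (Pi.single i 1)| ^ q) (Cube c b) :=
    h.abs.rpow_const fun x _ => Or.inr hq
  have h3 := h2.integrableOn_compact (μ := volume) (Cube_compact c b)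
  rw [← integrableOn_congr_set_ae (OCube_ae c b)] at h3 ⊢
  refine h3.congr_fun (fun x hx => ?_) (OCube_open c b).measurableSet
  have h1 : Cube c b ∈ nhds x :=
    Filter.mem_of_superset ((OCube_open c b).mem_nhds hx) (OCube_sub c b)
  simp only [Dop, fderivWithin_of_mem_nhds h1]

lemma u_int {N : ℕ} {c : Fin N → ℝ} {b : ℝ} {u : (Fin N → ℝ) → ℝ}
    (hu : ContDiffOn ℝ 1 u (Cube c b)) (q : ℝ) (hq : 0 ≤ q) :
    IntegrableOn (fun x => |u x| ^ q) (Cube c b) :=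
  (hu.continuousOn.abs.rpow_const fun x _ => Or.inr hq).integrableOn_compact (Cube_compact c b)

/-- The density. -/
def dens {N : ℕ} (q : Fin N → ℝ) (τ : ℝ) (u : (Fin N → ℝ) → ℝ) (x : Fin N → ℝ) : ℝ :=
  1 + |u x| ^ τ + ∑ i, |Dop i u x| ^ q i

lemma dens_nonneg {N : ℕ} (q : Fin N → ℝ) (τ : ℝ) (u : (Fin N → ℝ) → ℝ) (x : Fin N → ℝ) :
    0 ≤ dens q τ u x := by
  unfold dens; positivity

lemma dens_pt {N : ℕ} (b : ℝ) (hb : 0 < b) (q : Fin N → ℝ) (τ : ℝ) (u : (Fin N → ℝ) → ℝ)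
    (x : Fin N → ℝ) (i : Fin N) (hq : 1 < q i) (hqτ : q i ≤ τ) (w : ℝ)
    (hw : |w| = (1 + τ - τ / q i) * (|u x| ^ (τ - τ / q i) * |Dop i u x|)) :
    |u x| ^ (1 + τ - τ / q i) / b + |w| ≤ (1 / b + τ) * dens q τ u x := by
  have hq0 : 0 < q i := by linarith
  have h1 : 1 ≤ τ / q i := by rw [le_div_iff₀ hq0]; linarith
  have h2 : τ / q i ≤ τ := div_le_self (by linarith) hq.le
  have e1 : |u x| ^ (1 + τ - τ / q i) ≤ 1 + |u x| ^ τ :=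
    rpow_le_one_add _ _ _ (abs_nonneg _) (by linarith) (by linarith)
  have hc : (q i / (q i - 1)).HolderConjugate (q i) := by
    refine (Real.holderConjugate_iff.2 ⟨hq, ?_⟩ : (q i).HolderConjugate (q i / (q i - 1))).symm
    have : q i - 1 ≠ 0 := by linarith
    field_simp
    ring
  have e2 := young_one _ _ hc (|u x| ^ (τ - τ / q i)) |Dop i u x| (by positivity) (abs_nonneg _)
  rw [← Real.rpow_mul (abs_nonneg _)] at e2
  have e3 : (τ - τ / q i) * (q i / (q i - 1)) = τ := by
    have : q i - 1 ≠ 0 := by linarith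
    field_simp
  rw [e3] at e2
  have e4 : |Dop i u x| ^ q i ≤ ∑ i, |Dop i u x| ^ q i :=
    Finset.single_le_sum (f := fun i => |Dop i u x| ^ q i) (fun i _ => by positivity)
      (Finset.mem_univ i)
  have p1 : 0 ≤ |u x| ^ τ := by positivity
  have p2 : 0 ≤ |Dop i u x| ^ q i := by positivity
  rw [hw, add_mul]
  have d1 : 1 + |u x| ^ τ ≤ dens q τ u x := by unfold dens; linarith
  have d2 : |u x| ^ τ + |Dop i u x| ^ q i ≤ dens q τ u x := by unfold dens; linarith
  have f1 : |u x| ^ (1 + τ - τ / q i) / b ≤ 1 / b * dens q τ u x := by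
    rw [div_eq_mul_one_div, mul_comm]
    exact mul_le_mul_of_nonneg_left (e1.trans d1) (by positivity)
  have f2 : (1 + τ - τ / q i) * (|u x| ^ (τ - τ / q i) * |Dop i u x|) ≤ τ * dens q τ u x :=
    mul_le_mul (by linarith) (e2.trans d2) (by positivity) (by linarith)
  linarith

lemma cube_line {N : ℕ} {c : Fin N → ℝ} {b : ℝ} (hb : 0 < b) (q : Fin N → ℝ) (τ : ℝ)
    (hq : ∀ i, 1 < q i) (hqτ : ∀ i, q i ≤ τ) {u : (Fin N → ℝ) → ℝ}
    (hu : ContDiffOn ℝ 1 u (Cube c b)) {x : Fin N → ℝ} (hx : x ∈ OCube c b) (i : Fin N) :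
    ENNReal.ofReal (|u x| ^ (1 + τ - τ / q i)) ≤ ENNReal.ofReal (1 / b + τ) *
      ∫⁻ s, (OCube c b).indicator (fun y => ENNReal.ofReal (dens q τ u y))
        (Function.update x i s) := by
  have hq0 : 0 < q i := by linarith [hq i]
  have hτ : 1 < τ := (hq i).trans_le (hqτ i)
  have h1 : 1 ≤ τ / q i := by rw [le_div_iff₀ hq0]; linarith [hqτ i]
  have h2 : τ / q i < τ := div_lt_self (by linarith) (hq i)
  set κ := 1 + τ - τ / q i with hκ
  have hκ1 : 1 < κ := by rw [hκ]; linarith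
  have hmem : ∀ s ∈ Set.Ioo (c i) (c i + b), Function.update x i s ∈ OCube c b := by
    intro s hs k _
    by_cases hk : k = i
    · subst hk; simpa using hs
    · rw [Function.update_of_ne hk]; exact hx k (Set.mem_univ _)
  have hcu : Continuous fun s => Function.update x i s := continuous_const.update i continuous_id
  set g : ℝ → ℝ := fun s => |u (Function.update x i s)| ^ κ with hg
  set g' : ℝ → ℝ := fun s => κ * |u (Function.update x i s)| ^ (κ - 2) * u (Function.update x i s) *
    Dop i u (Function.update x i s) with hg'
  have hd : ∀ s ∈ Set.Ioo (c i) (c i + b), HasDerivAt g (g' s) s := by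
    intro s hs
    have a1 := (u_diff hu (hmem s hs)).comp_hasDerivAt s (hasDerivAt_update x i s)
    exact (hasDerivAt_abs_rpow _ hκ1).comp s a1
  have habs : ∀ s, |g' s| = κ * (|u (Function.update x i s)| ^ (κ - 1) *
      |Dop i u (Function.update x i s)|) := by
    intro s
    simp only [hg', abs_mul, abs_of_pos (show 0 < κ by linarith)]
    rw [abs_of_nonneg (by positivity : 0 ≤ |u (Function.update x i s)| ^ (κ - 2))]
    rcases eq_or_ne (u (Function.update x i s)) 0 with h0 | h0
    · rw [h0]; simp [Real.zero_rpow (show κ - 1 ≠ 0 by linarith)]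
    · rw [show κ - 1 = (κ - 2) + 1 by ring, Real.rpow_add_one (abs_ne_zero.2 h0)]
      ring
  have hcd : ContinuousOn g' (Set.Ioo (c i) (c i + b)) := by
    have hphi : Continuous fun y : ℝ => κ * |y| ^ (κ - 2) * y := by
      have he : (fun y : ℝ => κ * |y| ^ (κ - 2) * y) = deriv fun y : ℝ => |y| ^ κ :=
        funext fun y => ((hasDerivAt_abs_rpow y hκ1).deriv).symm
      rw [he]
      have := contDiff_norm_rpow (E := ℝ) hκ1
      simpa [Real.norm_eq_abs] using this.continuous_deriv le_rfl
    have c1 : ContinuousOn (fun s => u (Function.update x i s)) (Set.Ioo (c i) (c i + b)) :=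
      (hu.continuousOn.mono (OCube_sub c b)).comp hcu.continuousOn hmem
    have c2 : ContinuousOn (fun s => Dop i u (Function.update x i s)) (Set.Ioo (c i) (c i + b)) :=
      (Dop_cont hu i).comp hcu.continuousOn hmem
    exact (hphi.comp_continuousOn c1).mul c2
  have hxi := hx i (Set.mem_univ _)
  have key := line_bound_s14 (c i) (c i + b) (by linarith) g g' hd hcd (fun t => by positivity) (x i) hxi
  have hgx : g (x i) = |u x| ^ κ := by simp [hg]
  rw [hgx] at key
  refine key.trans ?_
  rw [← lintegral_const_mul' _ _ ENNReal.ofReal_ne_top]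
  rw [← lintegral_indicator measurableSet_Ioo]
  refine lintegral_mono fun s => ?_
  by_cases hs : s ∈ Set.Ioo (c i) (c i + b)
  · rw [Set.indicator_of_mem hs]
    simp only
    rw [Set.indicator_of_mem (hmem s hs),
      ← ENNReal.ofReal_mul (by positivity)]
    refine ENNReal.ofReal_le_ofReal ?_
    have := dens_pt b hb q τ u (Function.update x i s) i (hq i) (hqτ i) (g' s) (by
      rw [habs s, hκ]
      congr 3
      ring)
    rw [add_sub_cancel_left]
    exact this
  · rw [Set.indicator_of_notMem hs]; exact zero_le

lemma sobolev {N : ℕ} (hN : 2 ≤ N) {c : Fin N → ℝ} {b : ℝ} (hb : 0 < b) (q : Fin N → ℝ) (τ : ℝ)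
    (hq : ∀ i, 1 < q i) (hqτ : ∀ i, q i ≤ τ) {u : (Fin N → ℝ) → ℝ}
    (hu : ContDiffOn ℝ 1 u (Cube c b)) :
    ∫⁻ x in OCube c b, ENNReal.ofReal (|u x| ^ ((∑ i, (1 + τ - τ / q i)) / ((N : ℝ) - 1))) ≤
      (ENNReal.ofReal (1 / b + τ) * ∫⁻ x in OCube c b, ENNReal.ofReal (dens q τ u x)) ^
        ((N : ℝ) / (N - 1)) := by
  have hn : (2 : ℝ) ≤ N := by exact_mod_cast hN
  have hn1 : (0 : ℝ) < (N : ℝ) - 1 := by linarith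
  set F : (Fin N → ℝ) → ENNReal :=
    (OCube c b).indicator (fun y => ENNReal.ofReal (dens q τ u y)) with hF
  have hq0 : ∀ i, 0 < q i := fun i => by linarith [hq i]
  have hτ : 1 < τ := (hq ⟨0, by omega⟩).trans_le (hqτ _)
  have hFm : Measurable F := by
    have hc : ContinuousOn (fun y => ENNReal.ofReal (dens q τ u y)) (OCube c b) := by
      refine ENNReal.continuous_ofReal.comp_continuousOn ?_
      unfold dens
      refine ContinuousOn.add (ContinuousOn.add continuousOn_const ?_) ?_
      · exact (hu.continuousOn.mono (OCube_sub c b)).abs.rpow_const fun _ _ => Or.inr (by linarith)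
      · exact continuousOn_finsetSum _ fun i _ =>
          (Dop_cont hu i).abs.rpow_const fun _ _ => Or.inr (hq0 i).le
    classical
    have := hc.measurable_piecewise (g := 0) (continuousOn_const (c := (0 : ENNReal)))
      (OCube_open c b).measurableSet
    rwa [Set.piecewise_eq_indicator] at this
  have hcard : (Fintype.card (Fin N) : ℝ) = N := by simp
  have hconj : (Fintype.card (Fin N) : ℝ).HolderConjugate ((N : ℝ) / (N - 1)) := by
    rw [hcard]
    refine Real.holderConjugate_iff.2 ⟨by linarith, ?_⟩
    have : (N : ℝ) - 1 ≠ 0 := hn1.ne'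
    field_simp
    ring
  have key := lintegral_prod_lintegral_pow_le (fun _ : Fin N => (volume : Measure ℝ)) hconj hFm
  rw [← volume_pi, hcard] at key
  have hpt : ∀ x ∈ OCube c b,
      ENNReal.ofReal (|u x| ^ ((∑ i, (1 + τ - τ / q i)) / ((N : ℝ) - 1))) ≤
      (ENNReal.ofReal (1 / b + τ)) ^ ((N : ℝ) / (N - 1)) *
        ∏ i, (∫⁻ s, F (Function.update x i s)) ^ (1 / ((N : ℝ) - 1)) := by
    intro x hx
    have hκ : ∀ i, 0 ≤ 1 + τ - τ / q i := fun i => by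
      have : τ / q i ≤ τ := div_le_self (by linarith) (hq i).le
      linarith
    have e1 : |u x| ^ ((∑ i, (1 + τ - τ / q i)) / ((N : ℝ) - 1)) =
        ∏ i, (|u x| ^ (1 + τ - τ / q i)) ^ (1 / ((N : ℝ) - 1)) := by
      rw [Real.finsetProd_rpow _ _ (fun i _ => by positivity),
        ← Real.rpow_sum_of_nonneg (abs_nonneg _) (fun i _ => hκ i), ← Real.rpow_mul (abs_nonneg _),
        mul_one_div]
    rw [e1, ENNReal.ofReal_prod_of_nonneg (fun i _ => by positivity)]
    calc _ ≤ ∏ i, (ENNReal.ofReal (1 / b + τ) * ∫⁻ s, F (Function.update x i s)) ^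
          (1 / ((N : ℝ) - 1)) := by
          refine Finset.prod_le_prod' fun i _ => ?_
          rw [← ENNReal.ofReal_rpow_of_nonneg (by positivity) (by positivity)]
          exact ENNReal.rpow_le_rpow (cube_line hb q τ hq hqτ hu hx i) (by positivity)
      _ = _ := by
          simp_rw [ENNReal.mul_rpow_of_nonneg _ _ (show 0 ≤ 1 / ((N : ℝ) - 1) by positivity)]
          rw [Finset.prod_mul_distrib, Finset.prod_const, Finset.card_univ, Fintype.card_fin,
            ← ENNReal.rpow_natCast, ← ENNReal.rpow_mul, one_div_mul_eq_div]
  calc _ ≤ ∫⁻ x in OCube c b, (ENNReal.ofReal (1 / b + τ)) ^ ((N : ℝ) / (N - 1)) *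
        ∏ i, (∫⁻ s, F (Function.update x i s)) ^ (1 / ((N : ℝ) - 1)) :=
        setLIntegral_mono' (OCube_open c b).measurableSet hpt
    _ ≤ ∫⁻ x, (ENNReal.ofReal (1 / b + τ)) ^ ((N : ℝ) / (N - 1)) *
        ∏ i, (∫⁻ s, F (Function.update x i s)) ^ (1 / ((N : ℝ) - 1)) := setLIntegral_le_lintegral _ _
    _ ≤ (ENNReal.ofReal (1 / b + τ)) ^ ((N : ℝ) / (N - 1)) * (∫⁻ x, F x) ^ ((N : ℝ) / (N - 1)) := by
        rw [lintegral_const_mul' _ _ (ENNReal.rpow_ne_top_of_nonneg (by positivity)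
          ENNReal.ofReal_ne_top)]
        gcongr
    _ = _ := by
        rw [hF, lintegral_indicator (OCube_open c b).measurableSet,
          ENNReal.mul_rpow_of_nonneg _ _ (by positivity)]

lemma core_s14 {N : ℕ} (hN : 2 ≤ N) (c : Fin N → ℝ) (b : ℝ) (hb : 0 < b) (q : Fin N → ℝ) (τ : ℝ)
    (hq : ∀ i, 1 < q i) (hqτ : ∀ i, q i ≤ τ) (h2 : 2 < τ)
    (hS : τ * ∑ i, 1 / q i < N + 2) (M δ : ℝ) (hM : 0 < M) (hδ : 0 < δ) :
    ∃ C : ℝ, ∀ u : (Fin N → ℝ) → ℝ, ContDiffOn ℝ 1 u (Cube c b) →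
      ∫ x in Cube c b, |u x| ^ (2 : ℝ) ≤ M →
      ∫ x in Cube c b, |u x| ^ τ ≤ δ * (∑ i, ∫ x in Cube c b, |Dop i u x| ^ q i) + C := by
  have hn : (2 : ℝ) ≤ N := by exact_mod_cast hN
  have hn1 : (0 : ℝ) < (N : ℝ) - 1 := by linarith
  set n : ℝ := (N : ℝ) with hndef
  set S := ∑ i, 1 / q i with hSdef
  have hsum : ∑ i, (1 + τ - τ / q i) = n + n * τ - τ * S := by
    rw [Finset.sum_sub_distrib, Finset.sum_const, Finset.card_univ, Fintype.card_fin, nsmul_eq_mul,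
      hSdef, Finset.mul_sum]
    simp only [mul_one_div]
    rw [← hndef]; ring
  set m := (∑ i, (1 + τ - τ / q i)) / (n - 1) with hm
  have hm' : (n - 1) * m = n + n * τ - τ * S := by
    rw [hm, hsum]; field_simp
  have hm1 : n * (τ - 2) < (n - 1) * (m - 2) := by linarith
  have hm2 : 0 < m - 2 := by
    have : 0 < (n - 1) * (m - 2) := lt_of_le_of_lt (by nlinarith) hm1
    exact (pos_iff_pos_of_mul_pos this).1 hn1
  set θ := (τ - 2) / (m - 2) with hθ
  have hθ0 : 0 < θ := div_pos (by linarith) hm2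
  have hθm : θ * (m - 2) = τ - 2 := by rw [hθ]; field_simp
  have hκ1 : (n / (n - 1)) * θ < 1 := by
    rw [hθ, div_mul_div_comm, div_lt_one (by positivity)]
    exact hm1
  have hθ1 : θ ≤ 1 := by
    have : 1 ≤ n / (n - 1) := by rw [le_div_iff₀ hn1]; linarith
    nlinarith
  set κ := (n / (n - 1)) * θ with hκ
  have hκ0 : 0 < κ := by positivity
  have hK : 0 < 1 / b + τ := by positivity
  obtain ⟨C, hC⟩ := sublin κ (M ^ (1 - θ) * (1 / b + τ) ^ κ) (δ / (1 + δ)) hκ0 hκ1 (by positivity)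
    (by positivity)
  set V := ∫ x in Cube c b, (1 : ℝ) with hV
  have hV0 : 0 ≤ V := by positivity
  refine ⟨δ * V + (1 + δ) * C, fun u hu hu2 => ?_⟩
  have hUm := (OCube_open c b).measurableSet
  set X := ∫ x in Cube c b, |u x| ^ τ with hX
  set A := ∑ i, ∫ x in Cube c b, |Dop i u x| ^ q i with hA
  have hX0 : 0 ≤ X := integral_nonneg fun x => by positivity
  have hA0 : 0 ≤ A := Finset.sum_nonneg fun i _ => integral_nonneg fun x => by positivity
  have hre : volume.restrict (OCube c b) = volume.restrict (Cube c b) :=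
    Measure.restrict_congr_set (OCube_ae c b)
  have i1 : Integrable (fun _ : Fin N → ℝ => (1 : ℝ)) (volume.restrict (Cube c b)) :=
    (continuousOn_const (c := (1 : ℝ))).integrableOn_compact (Cube_compact c b)
  have i2 := u_int hu τ (by linarith)
  have i3 : ∀ i, Integrable (fun x => |Dop i u x| ^ q i) (volume.restrict (Cube c b)) :=
    fun i => Dop_int hb hu i (q i) (by linarith [hq i])
  have i4 : Integrable (dens q τ u) (volume.restrict (Cube c b)) :=
    (i1.add i2).add (integrable_finsetSum _ fun i _ => i3 i)
  have hdens : ∫ x in Cube c b, dens q τ u x = V + X + A := by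
    unfold dens
    have i12 : Integrable (fun x => 1 + |u x| ^ τ) (volume.restrict (Cube c b)) := i1.add i2
    rw [integral_add i12 (integrable_finsetSum _ fun i _ => i3 i), integral_add i1 i2,
      integral_finsetSum _ fun i _ => i3 i]
  have hL : ∫⁻ x in OCube c b, ENNReal.ofReal (dens q τ u x) = ENNReal.ofReal (V + X + A) := by
    rw [hre, ← hdens, ofReal_integral_eq_lintegral_ofReal i4
      (ae_of_all _ fun x => dens_nonneg q τ u x)]
  have hsob := sobolev hN hb q τ hq hqτ hu
  rw [hL, ← hndef, ← hm, ← ENNReal.ofReal_mul hK.le] at hsob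
  have hucont := hu.continuousOn.mono (OCube_sub c b)
  have hbnd : ENNReal.ofReal X ≤ ENNReal.ofReal M ^ (1 - θ) *
      (ENNReal.ofReal ((1 / b + τ) * (V + X + A)) ^ (n / (n - 1))) ^ θ := by
    have hm1 : AEMeasurable (fun x => ENNReal.ofReal (|u x| ^ (2 : ℝ)))
        (volume.restrict (OCube c b)) :=
      ((hucont.abs.rpow_const fun _ _ => Or.inr (by norm_num)).aemeasurable hUm).ennreal_ofReal
    have hm3 : AEMeasurable (fun x => ENNReal.ofReal (|u x| ^ m)) (volume.restrict (OCube c b)) :=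
      ((hucont.abs.rpow_const fun _ _ => Or.inr (by linarith)).aemeasurable hUm).ennreal_ofReal
    have := ENNReal.lintegral_mul_norm_pow_le hm1 hm3 (p := 1 - θ) (q := θ) (by linarith) hθ0.le
      (by ring)
    have e : ENNReal.ofReal X = ∫⁻ x in OCube c b, ENNReal.ofReal (|u x| ^ (2 : ℝ)) ^ (1 - θ) *
        ENNReal.ofReal (|u x| ^ m) ^ θ := by
      rw [hre, hX, ofReal_integral_eq_lintegral_ofReal i2 (ae_of_all _ fun x => by positivity)]
      refine lintegral_congr fun x => ?_
      rw [ENNReal.ofReal_rpow_of_nonneg (by positivity) (by linarith),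
        ENNReal.ofReal_rpow_of_nonneg (by positivity) hθ0.le, ← ENNReal.ofReal_mul (by positivity),
        ← Real.rpow_mul (abs_nonneg _), ← Real.rpow_mul (abs_nonneg _),
        ← Real.rpow_add_of_nonneg (abs_nonneg _) (by nlinarith) (by nlinarith)]
      congr 2
      linarith
    rw [e]
    refine this.trans ?_
    have e2 : ∫⁻ x in OCube c b, ENNReal.ofReal (|u x| ^ (2 : ℝ)) ≤ ENNReal.ofReal M := by
      rw [hre, ← ofReal_integral_eq_lintegral_ofReal (u_int hu 2 (by norm_num))
        (ae_of_all _ fun x => by positivity)]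
      exact ENNReal.ofReal_le_ofReal hu2
    refine mul_le_mul' (ENNReal.rpow_le_rpow e2 (by linarith)) (ENNReal.rpow_le_rpow hsob hθ0.le)
  have hY0 : 0 ≤ V + X + A := by positivity
  rw [← ENNReal.rpow_mul, ← hκ, ENNReal.ofReal_rpow_of_nonneg hM.le (by linarith),
    ENNReal.ofReal_rpow_of_nonneg (by positivity) hκ0.le, ← ENNReal.ofReal_mul (by positivity),
    ENNReal.ofReal_le_ofReal_iff (by positivity), Real.mul_rpow hK.le hY0, ← mul_assoc] at hbnd
  have h5 := hbnd.trans (hC _ hY0)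
  have h6 : (1 + δ) * X ≤ δ * (V + X + A) + (1 + δ) * C := by
    have := mul_le_mul_of_nonneg_left h5 (show 0 ≤ 1 + δ by linarith)
    rwa [mul_add, ← mul_assoc, mul_div_cancel₀ _ (show 1 + δ ≠ 0 by linarith)] at this
  linarith

lemma pointwise_est (q d τ lam : ℝ) (hd : 0 < d) (hdq : d < q) (hτ : 2 ≤ τ) (hσ : 2 * q / d ≤ τ)
    (hlam : 0 < lam) :
    ∃ C : ℝ, 0 ≤ C ∧ ∀ v w e s : ℝ, e ∈ Set.Ioo (0 : ℝ) 1 → 0 ≤ s → s ≤ q - d →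
      v ^ 2 * (e ^ 2 + w ^ 2) ^ (s / 2) ≤ lam * |w| ^ q + C * (1 + |v| ^ τ) := by
  have hq : 0 < q := hd.trans hdq
  have hqd : 0 < q - d := by linarith
  set B : ℝ := 2 ^ ((q - d) / 2) with hB
  have hB0 : 0 < B := by positivity
  have hc : (q / (q - d)).HolderConjugate (q / d) := by
    refine Real.holderConjugate_iff.2 ⟨?_, ?_⟩
    · rw [lt_div_iff₀ hqd]; linarith
    · field_simp; ring
  obtain ⟨C, hC0, hC⟩ := young_eps _ _ hc (lam / B) (by positivity)
  refine ⟨B * (1 + C), by positivity, fun v w e s he hs0 hs => ?_⟩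
  have h1 : (e ^ 2 + w ^ 2) ^ (s / 2) ≤ B * (1 + |w| ^ (q - d)) := by
    set m := max 1 |w| with hm
    have hm1 : 1 ≤ m := le_max_left _ _
    have a1 : e ^ 2 + w ^ 2 ≤ 2 * m ^ 2 := by
      have : |w| ≤ m := le_max_right _ _
      have h3 : w ^ 2 ≤ m ^ 2 := by rw [← sq_abs]; gcongr
      nlinarith [he.1, he.2]
    have a2 : 1 ≤ 2 * m ^ 2 := by nlinarith
    calc (e ^ 2 + w ^ 2) ^ (s / 2) ≤ (2 * m ^ 2) ^ (s / 2) := by gcongr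
      _ ≤ (2 * m ^ 2) ^ ((q - d) / 2) := Real.rpow_le_rpow_of_exponent_le a2 (by linarith)
      _ = B * m ^ (q - d) := by
          rw [Real.mul_rpow (by norm_num) (by positivity), ← Real.rpow_natCast m 2,
            ← Real.rpow_mul (by linarith)]
          congr 2
          push_cast; ring
      _ ≤ B * (1 + |w| ^ (q - d)) := by
          gcongr
          have : 0 ≤ |w| ^ (q - d) := by positivity
          rcases max_cases 1 |w| with ⟨h, _⟩ | ⟨h, _⟩
          · rw [hm, h, Real.one_rpow]; linarith
          · rw [hm, h]; linarith
  have h2 := hC (|w| ^ (q - d)) (v ^ 2) (by positivity) (by positivity)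
  have e1 : (|w| ^ (q - d)) ^ (q / (q - d)) = |w| ^ q := by
    rw [← Real.rpow_mul (abs_nonneg _), mul_div_cancel₀ _ hqd.ne']
  have e0 : v ^ 2 = |v| ^ (2 : ℝ) := by rw [Real.rpow_two, sq_abs]
  have e2 : (v ^ 2) ^ (q / d) = |v| ^ (2 * q / d) := by
    rw [e0, ← Real.rpow_mul (abs_nonneg _), mul_div_assoc]
  rw [e1, e2] at h2
  have h3 : |v| ^ (2 * q / d) ≤ 1 + |v| ^ τ :=
    rpow_le_one_add _ _ _ (abs_nonneg _) (by positivity) hσ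
  have h4 : v ^ 2 ≤ 1 + |v| ^ τ := by
    rw [e0]; exact rpow_le_one_add _ _ _ (abs_nonneg _) (by norm_num) hτ
  calc v ^ 2 * (e ^ 2 + w ^ 2) ^ (s / 2) ≤ v ^ 2 * (B * (1 + |w| ^ (q - d))) := by gcongr
    _ = B * (v ^ 2 + |w| ^ (q - d) * v ^ 2) := by ring
    _ ≤ B * ((1 + |v| ^ τ) + (lam / B * |w| ^ q + C * (1 + |v| ^ τ))) := by
        gcongr
        exact h2.trans (by gcongr)
    _ = _ := by field_simp; ring

lemma cube_est {N : ℕ} (hN : 2 ≤ N) (c : Fin N → ℝ) (b : ℝ) (hb : 0 < b) (q : Fin N → ℝ) (τ : ℝ)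
    (hq : ∀ i, 1 < q i) (hqτ : ∀ i, q i ≤ τ) (h2 : 2 < τ)
    (hS : τ * ∑ i, 1 / q i < N + 2) (j : Fin N) (d : ℝ) (hd : 0 < d) (hdq : d < q j)
    (hσ : 2 * q j / d ≤ τ) (s : (Fin N → ℝ) → ℝ) (hs : ∀ x ∈ Cube c b, 0 ≤ s x ∧ s x ≤ q j - d)
    (M₀ : ℝ) (hM : 0 < M₀) (lam : ℝ) (hlam : 0 < lam) :
    ∃ C : ℝ, ∀ ε ∈ Set.Ioo (0 : ℝ) 1,
        ∀ u : (Fin N → ℝ) → ℝ, ContDiffOn ℝ 1 u (Cube c b) →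
          Lnorm 2 (Cube c b) u ≤ M₀ →
          (∫ x in Cube c b, (u x) ^ 2 * (ε ^ 2 + (Dop j u x) ^ 2) ^ (s x / 2)) ≤
            lam * (∑ i, ∫ x in Cube c b, |Dop i u x| ^ q i) + C := by
  obtain ⟨C₁, hC₁0, hC₁⟩ := pointwise_est (q j) d τ (lam / 2) hd hdq h2.le hσ (by positivity)
  obtain ⟨C₂, hC₂⟩ := core_s14 hN c b hb q τ hq hqτ h2 hS (M₀ ^ 2) (lam / (2 * (C₁ + 1)))
    (by positivity) (by positivity)
  refine ⟨C₁ * ((∫ _ in Cube c b, (1 : ℝ)) + C₂), fun ε hε u hu hL => ?_⟩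
  have hL2 : ∫ x in Cube c b, |u x| ^ (2 : ℝ) ≤ M₀ ^ 2 := by
    unfold Lnorm at hL
    have h0 : 0 ≤ ∫ x in Cube c b, |u x| ^ (2 : ℝ) := integral_nonneg fun x => by positivity
    rw [← Real.sqrt_eq_rpow] at hL
    exact (Real.sqrt_le_left hM.le).1 hL
  have h3 := hC₂ u hu hL2
  have i1 : Integrable (fun _ : Fin N → ℝ => (1 : ℝ)) (volume.restrict (Cube c b)) :=
    (continuousOn_const (c := (1 : ℝ))).integrableOn_compact (Cube_compact c b)
  have i2 : Integrable (fun x => |u x| ^ τ) (volume.restrict (Cube c b)) := u_int hu τ (by linarith)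
  have i3 : Integrable (fun x => |Dop j u x| ^ q j) (volume.restrict (Cube c b)) :=
    Dop_int hb hu j (q j) (by linarith [hq j])
  have h4 : (∫ x in Cube c b, (u x) ^ 2 * (ε ^ 2 + (Dop j u x) ^ 2) ^ (s x / 2)) ≤
      ∫ x in Cube c b, (lam / 2 * |Dop j u x| ^ q j + C₁ * (1 + |u x| ^ τ)) := by
    refine integral_mono_of_nonneg (ae_of_all _ fun x => by positivity)
      ((i3.const_mul _).add ((i1.add i2).const_mul _)) ?_
    filter_upwards [ae_restrict_mem (Cube_meas c b)] with x hx
    exact hC₁ _ _ _ _ hε (hs x hx).1 (hs x hx).2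
  have i12 : Integrable (fun x => 1 + |u x| ^ τ) (volume.restrict (Cube c b)) := i1.add i2
  rw [integral_add (i3.const_mul _) (i12.const_mul _), integral_const_mul, integral_const_mul,
    integral_add i1 i2] at h4
  set A := ∑ i, ∫ x in Cube c b, |Dop i u x| ^ q i with hA
  have h5 : ∫ x in Cube c b, |Dop j u x| ^ q j ≤ A :=
    Finset.single_le_sum (f := fun i => ∫ x in Cube c b, |Dop i u x| ^ q i)
      (fun i _ => integral_nonneg fun x => by positivity) (Finset.mem_univ j)
  have hA0 : 0 ≤ A := Finset.sum_nonneg fun i _ => integral_nonneg fun x => by positivity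
  have h6 : C₁ * (lam / (2 * (C₁ + 1)) * A) ≤ lam / 2 * A := by
    rw [← mul_assoc]
    gcongr
    rw [mul_div_assoc', div_le_div_iff₀ (by positivity) (by norm_num)]
    nlinarith
  have h7 := mul_le_mul_of_nonneg_left h3 hC₁0
  have h8 : lam / 2 * ∫ x in Cube c b, |Dop j u x| ^ q j ≤ lam / 2 * A := by gcongr
  linarith

theorem stmt14 (N : ℕ) (hN : 2 ≤ N) (hne : (Finset.univ : Finset (Fin N)).Nonempty)
    (a : Fin N → ℝ) (ha : ∀ i, 0 < a i) (L : ℝ) (hL : 0 ≤ L)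
    (p : Fin N → (Fin N → ℝ) → ℝ)
    (hLip : ∀ j, ∀ x ∈ closure (Ka a), ∀ y ∈ closure (Ka a),
      |p j x - p j y| ≤ L * Real.sqrt (∑ i, (x i - y i) ^ 2))
    (hp : ∀ j, ∀ x ∈ closure (Ka a), 2 * N / (N + 2) < p j x)
    (μ : ℝ)
    (hμdef : μ = sSup ((fun x =>
      (Finset.univ.sup' hne fun j => p j x) / (Finset.univ.inf' hne fun j => p j x)) '' Ka a))
    (hμ : μ < 1 + 1 / N) :
    ∃ β γ : ℝ, 0 < β ∧
      γ = 2 * β * L * Real.sqrt N * ((N + 2) ^ 2 / (4 * N ^ 2)) *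
        ((Finset.univ.sup' hne fun j => sSup (p j '' closure (Ka a))) +
          (Finset.univ.inf' hne fun j => sInf (p j '' closure (Ka a))) + 2) ∧
      μ + γ < 1 + 1 / N ∧
      ∀ (c : Fin N → ℝ) (b : ℝ), 0 < b → b ≤ β → Cube c b ⊆ closure (Ka a) →
      ∀ r : ℝ, 2 / (N + 2) < r → r < 2 - (μ + γ) * (2 * N / (N + 2)) →
      ∀ j : Fin N, ∀ M₀ : ℝ, 0 < M₀ → ∀ lam : ℝ, 0 < lam →
      ∃ C : ℝ, ∀ ε ∈ Set.Ioo (0 : ℝ) 1,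
        ∀ u : (Fin N → ℝ) → ℝ, ContDiffOn ℝ 1 u (Cube c b) →
          Lnorm 2 (Cube c b) u ≤ M₀ →
          (∫ x in Cube c b,
              (u x) ^ 2 * (ε ^ 2 + (Dop j u x) ^ 2) ^ ((p j x + 2 * (r - 1)) / 2)) ≤
            lam * (∑ i, ∫ x in Cube c b, |Dop i u x| ^ (sInf (p i '' Cube c b) + r)) + C := by
  have hn : (2 : ℝ) ≤ N := by exact_mod_cast hN
  have hn0 : (0 : ℝ) < N := by linarith
  have hpc : ∀ j, ContinuousOn (p j) (closure (Ka a)) := by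
    intro j x hx
    rw [ContinuousWithinAt, tendsto_iff_norm_sub_tendsto_zero]
    have ht : Filter.Tendsto (fun y : Fin N → ℝ => L * Real.sqrt (∑ i, (y i - x i) ^ 2))
        (nhdsWithin x (closure (Ka a))) (nhds 0) := by
      have hcont : Continuous fun y : Fin N → ℝ => L * Real.sqrt (∑ i, (y i - x i) ^ 2) := by
        fun_prop
      have := hcont.tendsto x
      simp only [sub_self, ne_eq, OfNat.ofNat_ne_zero, not_false_eq_true, zero_pow,
        Finset.sum_const_zero, Real.sqrt_zero, mul_zero] at this
      exact this.mono_left nhdsWithin_le_nhds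
    refine tendsto_of_tendsto_of_tendsto_of_le_of_le' tendsto_const_nhds ht
      (Filter.Eventually.of_forall fun y => norm_nonneg _) ?_
    filter_upwards [self_mem_nhdsWithin] with y hy
    exact hLip j y hy x hx
  have hk0 : (0 : ℝ) < 2 * N / (N + 2) := by positivity
  have hpos : ∀ j, ∀ x ∈ closure (Ka a), 0 < p j x := fun j x hx => hk0.trans (hp j x hx)
  have hcpt : IsCompact (closure (Ka a)) := by
    refine (isCompact_Icc (a := -a) (b := a)).closure_of_subset ?_
    intro x hx
    exact ⟨fun i => (abs_lt.1 (hx i)).1.le, fun i => (abs_lt.1 (hx i)).2.le⟩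
  have hinf : ∀ x ∈ closure (Ka a), 0 < Finset.univ.inf' hne fun j => p j x := by
    intro x hx
    rw [Finset.lt_inf'_iff]
    exact fun j _ => hpos j x hx
  have hbdd : BddAbove ((fun x =>
      (Finset.univ.sup' hne fun j => p j x) / (Finset.univ.inf' hne fun j => p j x)) '' Ka a) := by
    refine (hcpt.bddAbove_image (f := fun x =>
      (Finset.univ.sup' hne fun j => p j x) / (Finset.univ.inf' hne fun j => p j x)) ?_).mono
      (Set.image_mono subset_closure)
    exact (ContinuousOn.finset_sup'_apply hne fun j _ => hpc j).div
      (ContinuousOn.finset_inf'_apply hne fun j _ => hpc j) fun x hx => (hinf x hx).ne'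
  have hratio : ∀ i j, ∀ x ∈ closure (Ka a), p j x ≤ μ * p i x := by
    intro i j
    refine le_on_closure (fun x hx => ?_) (hpc j) (continuousOn_const.mul (hpc i))
    have hx' := subset_closure hx
    have h1 := le_csSup hbdd (Set.mem_image_of_mem _ hx)
    rw [← hμdef] at h1
    have h2 : p j x ≤ Finset.univ.sup' hne fun j => p j x :=
      Finset.le_sup' (fun j => p j x) (Finset.mem_univ j)
    have h3 : (Finset.univ.inf' hne fun j => p j x) ≤ p i x :=
      Finset.inf'_le (fun j => p j x) (Finset.mem_univ i)
    have h4 := hinf x hx'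
    rw [div_le_iff₀ h4] at h1
    have h5 : 0 ≤ μ := by
      by_contra hneg
      push Not at hneg
      nlinarith [hpos j x hx']
    nlinarith
  have hμ1 : 1 ≤ μ := by
    have h0 : (0 : Fin N → ℝ) ∈ closure (Ka a) := subset_closure fun i => by simpa using ha i
    have := hratio ⟨0, by omega⟩ ⟨0, by omega⟩ 0 h0
    nlinarith [hpos ⟨0, by omega⟩ 0 h0]
  set G := (Finset.univ.sup' hne fun j => sSup (p j '' closure (Ka a))) +
          (Finset.univ.inf' hne fun j => sInf (p j '' closure (Ka a))) + 2 with hG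
  have hG2 : 2 ≤ G := by
    have h1 : 0 ≤ Finset.univ.sup' hne fun j => sSup (p j '' closure (Ka a)) := by
      obtain ⟨j, hj⟩ := hne
      refine le_trans ?_ (Finset.le_sup' (fun j => sSup (p j '' closure (Ka a))) hj)
      refine Real.sSup_nonneg ?_
      rintro _ ⟨x, hx, rfl⟩
      exact (hpos j x hx).le
    have h2 : 0 ≤ Finset.univ.inf' hne fun j => sInf (p j '' closure (Ka a)) := by
      rw [Finset.le_inf'_iff]
      intro j _
      refine Real.sInf_nonneg ?_
      rintro _ ⟨x, hx, rfl⟩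
      exact (hpos j x hx).le
    linarith
  set E := 2 * L * Real.sqrt N * ((N + 2) ^ 2 / (4 * N ^ 2)) * G with hE
  have hE0 : 0 ≤ E := by positivity
  set g := 1 + 1 / (N : ℝ) - μ with hg
  have hg0 : 0 < g := by linarith
  refine ⟨g / (2 * (E + 1)), g / (2 * (E + 1)) * E, by positivity, by rw [hE]; ring, ?_, ?_⟩
  · have : g / (2 * (E + 1)) * E < g := by
      rw [div_mul_eq_mul_div, div_lt_iff₀ (by positivity)]
      nlinarith
    linarith
  generalize hβ : g / (2 * (E + 1)) = β
  have hβ0 : 0 < β := by rw [← hβ]; positivity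
  intro c b hb hbβ hsub r hr1 hr2 j M₀ hM lam hlam
  have hr0 : 0 < r := lt_trans (by positivity) hr1
  have hγ : L * Real.sqrt N * b ≤ β * E * (2 * N / (N + 2)) := by
    have e : β * E * (2 * N / (N + 2)) = L * Real.sqrt N * (β * (((N : ℝ) + 2) / N * G)) := by
      rw [hE]; field_simp; ring
    rw [e]
    have h1 : 1 ≤ ((N : ℝ) + 2) / N := by rw [le_div_iff₀ hn0]; linarith
    have h2 : 1 ≤ ((N : ℝ) + 2) / N * G := by nlinarith
    refine mul_le_mul_of_nonneg_left ?_ (by positivity)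
    nlinarith
  have hcne : (Cube c b).Nonempty := ⟨c, fun i => ⟨le_rfl, by linarith⟩⟩
  have hmin : ∀ i, ∃ x ∈ Cube c b, sInf (p i '' Cube c b) = p i x ∧ ∀ y ∈ Cube c b, p i x ≤ p i y :=
    fun i => (Cube_compact c b).exists_sInf_image_eq_and_le hcne ((hpc i).mono hsub)
  choose z hz hzinf hzle using hmin
  set q : Fin N → ℝ := fun i => sInf (p i '' Cube c b) + r with hqdef
  have hq : ∀ i, q i = p i (z i) + r := fun i => by simp only [hqdef, hzinf]
  have hqlow : ∀ i, (2 * N + 2) / ((N : ℝ) + 2) < q i := by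
    intro i
    have := hp i _ (hsub (hz i))
    rw [hq, add_div]
    linarith
  have hq1 : ∀ i, 1 < q i := by
    intro i
    refine lt_of_le_of_lt ?_ (hqlow i)
    rw [le_div_iff₀ (by positivity)]
    linarith
  have hq0 : ∀ i, 0 < q i := fun i => by linarith [hq1 i]
  have hqq : ∀ i k, q k ≤ μ * q i := by
    intro i k
    have h1 := hzle k _ (hz i)
    have h2 := hratio i k _ (hsub (hz i))
    rw [hq, hq]
    nlinarith
  set S := ∑ i, 1 / q i with hSdef
  have hSpos : 0 < S := Finset.sum_pos (fun i _ => one_div_pos.2 (hq0 i)) hne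
  have hqS : ∀ k, q k * S ≤ N * μ := by
    intro k
    rw [hSdef, Finset.mul_sum]
    calc ∑ i, q k * (1 / q i) ≤ ∑ _i : Fin N, μ := by
          refine Finset.sum_le_sum fun i _ => ?_
          rw [mul_one_div, div_le_iff₀ (hq0 i)]
          exact hqq i k
      _ = N * μ := by simp
  have hNμ : N * μ < N + 1 := by
    have := mul_lt_mul_of_pos_left hμ hn0
    rwa [mul_add, mul_one, mul_one_div_cancel hn0.ne'] at this
  have h2S : 2 * S < N + 2 := by
    have h1 : S ≤ ∑ _i : Fin N, ((N : ℝ) + 2) / (2 * N + 2) := by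
      refine Finset.sum_le_sum fun i _ => ?_
      rw [← one_div_div (2 * (N : ℝ) + 2)]
      exact one_div_le_one_div_of_le (by positivity) (hqlow i).le
    have h2 : ∑ _i : Fin N, ((N : ℝ) + 2) / (2 * N + 2) = N * (((N : ℝ) + 2) / (2 * N + 2)) := by
      simp
    rw [h2] at h1
    have h3 : 2 * (N * (((N : ℝ) + 2) / (2 * N + 2))) < N + 2 := by
      rw [mul_div_assoc', mul_div_assoc', div_lt_iff₀ (by positivity)]
      nlinarith
    linarith
  set d := 2 - r - L * Real.sqrt N * b with hd
  have hdlow : μ * (2 * N / (N + 2)) < d := by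
    rw [hd]
    have : (μ + β * E) * (2 * N / (N + 2)) = μ * (2 * N / (N + 2)) + β * E * (2 * N / (N + 2)) := by
      ring
    linarith
  have hd0 : 0 < d := lt_trans (by positivity) hdlow
  have hσS : 2 * q j / d * S < N + 2 := by
    rw [div_mul_eq_mul_div, div_lt_iff₀ hd0]
    have h1 := hqS j
    have h2 : 2 * (N * μ) < (N + 2) * d := by
      rw [mul_div_assoc', div_lt_iff₀ (by positivity)] at hdlow
      linarith
    linarith
  have hdiam : ∀ x ∈ Cube c b, ∀ y ∈ Cube c b,
      Real.sqrt (∑ i, (x i - y i) ^ 2) ≤ Real.sqrt N * b := by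
    intro x hx y hy
    have h1 : ∑ i, (x i - y i) ^ 2 ≤ N * b ^ 2 := by
      calc ∑ i, (x i - y i) ^ 2 ≤ ∑ _i : Fin N, b ^ 2 := by
            refine Finset.sum_le_sum fun i _ => ?_
            have h1 := hx i
            have h2 := hy i
            exact sq_le_sq' (by linarith [h1.1, h2.2]) (by linarith [h1.2, h2.1])
        _ = N * b ^ 2 := by simp
    calc _ ≤ Real.sqrt (N * b ^ 2) := Real.sqrt_le_sqrt h1
      _ = _ := by rw [Real.sqrt_mul hn0.le, Real.sqrt_sq hb.le]
  have hs : ∀ x ∈ Cube c b, 0 < p j x + 2 * (r - 1) ∧ p j x + 2 * (r - 1) ≤ q j - d := by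
    intro x hx
    constructor
    · have h1 := hp j x (hsub hx)
      have h2 : 2 * (N : ℝ) / (N + 2) + 2 * (2 / (N + 2)) = 2 := by field_simp
      linarith
    · have h1 := hLip j x (hsub hx) (z j) (hsub (hz j))
      have h2 := mul_le_mul_of_nonneg_left (hdiam x hx (z j) (hz j)) hL
      have h3 := le_abs_self (p j x - p j (z j))
      rw [hq, hd]
      linarith
  have hdq : d < q j := by
    have := hs _ (hz j)
    linarith [this.1, this.2]
  obtain ⟨τ, hτ1, hτ2⟩ := exists_between
    (show max (max 2 (2 * q j / d)) (Finset.univ.sup' hne q) < ((N : ℝ) + 2) / S by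
      refine max_lt (max_lt ?_ ?_) ?_
      · rwa [lt_div_iff₀ hSpos]
      · rwa [lt_div_iff₀ hSpos]
      · rw [Finset.sup'_lt_iff]
        intro i _
        rw [lt_div_iff₀ hSpos]
        linarith [hqS i])
  rw [max_lt_iff, max_lt_iff, Finset.sup'_lt_iff] at hτ1
  rw [lt_div_iff₀ hSpos] at hτ2
  exact cube_est hN c b hb q τ hq1 (fun i => (hτ1.2 i (Finset.mem_univ i)).le) hτ1.1.1 hτ2 j d hd0
    hdq hτ1.1.2.le (fun x => p j x + 2 * (r - 1)) (fun x hx => ⟨(hs x hx).1.le, (hs x hx).2⟩)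
    M₀ hM lam hlam
end
end
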